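/- arXiv:1205.2066 — 5 statements merged into one kernel-verified Lean document; each statement's English description precedes it below -/
import Mathlib

section
/- The 2n×2n matrix L and the 2n×n matrix B̃ of the level-1 ice quiver with z-pattern form a unitally compatible pair up to a factor 2: L·(−B̃) equals the 2n×n matrix whose top n×n block is 2·I_n and whose bottom n×n block is 0. -/
namespace GQV

open Matrix

/-- Degree shift `η[d]`, i.e. `η[d]ᵢ(a) = ηᵢ(a + d)`. -/
noncomputable def shift {n : ℕ} (η : Fin n × ℝ → ℤ) (d : ℝ) : Fin n × ℝ → ℤ :=
  fun p => η (p.1, p.2 + d)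

/-- The q-Cartan operator `C_q`. -/
noncomputable def Cq {n : ℕ} (b : Matrix (Fin n) (Fin n) ℤ) (η : Fin n × ℝ → ℤ) : Fin n × ℝ → ℤ :=
  fun p =>
    η (p.1, p.2 + 1 / 2) + η (p.1, p.2 - 1 / 2)
      - ∑ i : Fin n, (if i < p.1 then b i p.1 * η (i, p.2 + 1 / 2) else 0)
      - ∑ j : Fin n, (if p.1 < j then b p.1 j * η (j, p.2 - 1 / 2) else 0)

/-- The pairing `η¹ · η² = Σ_{(i,a)} η¹ᵢ(a) η²ᵢ(a)`. -/
noncomputable def dotP {n : ℕ} (η₁ η₂ : Fin n × ℝ → ℤ) : ℤ := ∑ᶠ p, η₁ p * η₂ p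

/-- The indicator function `e_{k,a}` of `(k,a)`. -/
noncomputable def eind {n : ℕ} (k : Fin n) (a : ℝ) : Fin n × ℝ → ℤ := fun p => if p = (k, a) then 1 else 0

/-- Support contained in `I × ℤ`. -/
def SuppInt {n : ℕ} (η : Fin n × ℝ → ℤ) : Prop := ∀ p, η p ≠ 0 → ∃ m : ℤ, p.2 = (m : ℝ)

/-- Support contained in `I × (ℤ + 1/2)`. -/
def SuppHalfInt {n : ℕ} (η : Fin n × ℝ → ℤ) : Prop :=
  ∀ p, η p ≠ 0 → ∃ m : ℤ, p.2 = (m : ℝ) + 1 / 2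

/-- The set `E`: functions supported on integer arguments, vanishing for all
sufficiently small arguments. -/
def memE {n : ℕ} (η : Fin n × ℝ → ℤ) : Prop :=
  SuppInt η ∧ ∃ N : ℤ, ∀ (k : Fin n) (a : ℝ), a < (N : ℝ) → η (k, a) = 0

/-- The set `E[d] = {η[d] : η ∈ E}`. -/
def memEshift {n : ℕ} (d : ℝ) (η : Fin n × ℝ → ℤ) : Prop :=
  ∃ θ, memE θ ∧ η = shift θ d

/-- Functions on `I × (ℤ + 1/2)` vanishing for all sufficiently small arguments;
this is the set `E[1/2] = E[-1/2]`. -/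
def memEhalf {n : ℕ} (η : Fin n × ℝ → ℤ) : Prop :=
  SuppHalfInt η ∧ ∃ N : ℤ, ∀ (k : Fin n) (a : ℝ), a < (N : ℝ) → η (k, a) = 0

/-- The strictly upper triangular part `b^>`. -/
def bUpper {n : ℕ} (b : Matrix (Fin n) (Fin n) ℤ) : Matrix (Fin n) (Fin n) ℤ :=
  Matrix.of fun i j => if i < j then b i j else 0

/-- `E_Q = 1 - b^>`, the matrix of the Euler form. -/
def EQmat {n : ℕ} (b : Matrix (Fin n) (Fin n) ℤ) : Matrix (Fin n) (Fin n) ℤ := 1 - bUpper b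

/-- The Euler form `⟨x, y⟩ = xᵀ E_Q y`. -/
def euler {n : ℕ} (b : Matrix (Fin n) (Fin n) ℤ) (x y : Fin n → ℤ) : ℤ :=
  x ⬝ᵥ (EQmat b *ᵥ y)

/-- The class `[Ī_i] = E_Q⁻¹ e_i` of the indecomposable injective with socle `S_i`. -/
noncomputable def Iinj {n : ℕ} (b : Matrix (Fin n) (Fin n) ℤ) (i : Fin n) : Fin n → ℤ :=
  (EQmat b)⁻¹ *ᵥ Pi.single i 1

/-- The class `[P̄_i] = E_Q⁻ᵀ e_i` of the indecomposable projective with top `S_i`. -/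
noncomputable def Pproj {n : ℕ} (b : Matrix (Fin n) (Fin n) ℤ) (i : Fin n) : Fin n → ℤ :=
  ((EQmat b)ᵀ)⁻¹ *ᵥ Pi.single i 1

/-- The Coxeter matrix `Φ = -E_Q⁻¹ E_Qᵀ`. -/
noncomputable def Cox {n : ℕ} (b : Matrix (Fin n) (Fin n) ℤ) : Matrix (Fin n) (Fin n) ℤ :=
  -((EQmat b)⁻¹ * (EQmat b)ᵀ)

/-- The map `β`, defined `ℤ`-linearly by `β(e_{i,a}) = -Φ^a [Ī_i]` for `a ∈ ℤ`. -/
noncomputable def betaMap {n : ℕ} (b : Matrix (Fin n) (Fin n) ℤ) (η : Fin n × ℝ → ℤ) :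
    Fin n → ℤ :=
  ∑ᶠ p : Fin n × ℤ, η (p.1, (p.2 : ℝ)) • ((-(Cox b ^ p.2)) *ᵥ Iinj b p.1)

/-- `𝒩(w¹,w²) = w¹[1/2]·C_q⁻¹w² − w¹[−1/2]·C_q⁻¹w² − w²[1/2]·C_q⁻¹w¹ + w²[−1/2]·C_q⁻¹w¹`,
where `u₁ = C_q⁻¹ w¹`, `u₂ = C_q⁻¹ w²` are given as arguments. -/
noncomputable def Ncal {n : ℕ} (w₁ w₂ u₁ u₂ : Fin n × ℝ → ℤ) : ℤ :=
  dotP (shift w₁ (1 / 2)) u₂ - dotP (shift w₁ (-(1 / 2))) u₂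
    - dotP (shift w₂ (1 / 2)) u₁ + dotP (shift w₂ (-(1 / 2))) u₁

/-- `ℰ'(w¹,w²) = −w¹[1/2]·C_q⁻¹w² + w²[1/2]·C_q⁻¹w¹`, where `u₁ = C_q⁻¹ w¹`,
`u₂ = C_q⁻¹ w²` are given as arguments. -/
noncomputable def Ecal {n : ℕ} (w₁ w₂ u₁ u₂ : Fin n × ℝ → ℤ) : ℤ :=
  -dotP (shift w₁ (1 / 2)) u₂ + dotP (shift w₂ (1 / 2)) u₁

/-- The B-matrix of the level-1 ice quiver with z-pattern attached to `Q`. -/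
def Btilde {n : ℕ} (b : Matrix (Fin n) (Fin n) ℤ) : Matrix (Fin n ⊕ Fin n) (Fin n) ℤ :=
  Matrix.of (Sum.elim (fun i k => b i k)
    (fun j k => -(if j = k then 1 else 0) + (if k < j then b k j else 0)))

/-- The index map: the `ℤ`-linear map on functions supported on `I × {-1, 0}`
with `ind(e_{k,0}) = e_k` and `ind(e_{k,-1}) = e_{n+k} - e_k`. -/
noncomputable def indMap {n : ℕ} (w : Fin n × ℝ → ℤ) : Fin n ⊕ Fin n → ℤ :=
  Sum.elim (fun k => w (k, 0) - w (k, -1)) (fun k => w (k, -1))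

end GQV


open Matrix GQV

namespace GQV

lemma EQ_det {n : ℕ} (b : Matrix (Fin n) (Fin n) ℤ) : (EQmat b).det = 1 := by
  rw [Matrix.det_of_upperTriangular]
  · apply Finset.prod_eq_one
    intro i _
    simp [EQmat, bUpper]
  · intro i j hij
    have h : j < i := hij
    simp [EQmat, bUpper, not_lt.mpr h.le, Matrix.one_apply, h.ne']

lemma Cq_eq {n : ℕ} (b : Matrix (Fin n) (Fin n) ℤ) (η : Fin n × ℝ → ℤ) (k : Fin n) (a : ℝ) :
    Cq b η (k, a) = ((EQmat b)ᵀ *ᵥ (fun i => η (i, a + 1 / 2))) k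
      + (EQmat b *ᵥ (fun i => η (i, a - 1 / 2))) k := by
  have h1 : (EQmat b)ᵀ = 1 - (bUpper b)ᵀ := by simp [EQmat]
  rw [h1, EQmat, Matrix.sub_mulVec, Matrix.sub_mulVec, Matrix.one_mulVec, Matrix.one_mulVec]
  simp only [Cq, Pi.sub_apply, Matrix.mulVec, dotProduct, bUpper, Matrix.of_apply,
    Matrix.transpose_apply, ite_mul, zero_mul]
  ring

lemma vanish {n : ℕ} (b : Matrix (Fin n) (Fin n) ℤ) (η : Fin n × ℝ → ℤ) (h : memEhalf η)
    (c : ℝ) (hc : ∀ k a, a < c → Cq b η (k, a) = 0) :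
    ∀ a, a ≤ c - 1 / 2 → (fun k => η (k, a)) = 0 := by
  obtain ⟨-, N, hN⟩ := h
  have key : ∀ t : ℕ, ∀ a : ℝ, a < N + t → a ≤ c - 1 / 2 → (fun k => η (k, a)) = 0 := by
    intro t
    induction t with
    | zero =>
      intro a ha _
      funext k
      exact hN k a (by simpa using ha)
    | succ t ih =>
      intro a ha hac
      have h0 := ih (a - 1) (by push_cast at ha; linarith) (by linarith)
      have h2 : (EQmat b)ᵀ *ᵥ (fun i => η (i, a)) = 0 := by
        funext k
        have h1 := hc k (a - 1 / 2) (by linarith)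
        rw [Cq_eq] at h1
        have e1 : a - 1 / 2 + 1 / 2 = a := by ring
        have e2 : a - 1 / 2 - 1 / 2 = a - 1 := by ring
        rw [e1, e2, h0, Matrix.mulVec_zero] at h1
        simpa using h1
      exact Matrix.eq_zero_of_mulVec_eq_zero (by rw [Matrix.det_transpose, EQ_det]; simp) h2
  intro a ha
  obtain ⟨t, ht⟩ := exists_nat_gt (a - N)
  exact key t a (by linarith) ha

lemma shift_eind {n : ℕ} (i : Fin n) (c d : ℝ) : shift (eind i c) d = eind i (c - d) := by
  funext p
  obtain ⟨k, a⟩ := p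
  simp only [shift, eind, Prod.mk.injEq, eq_sub_iff_add_eq]

lemma shift_add {n : ℕ} (η θ : Fin n × ℝ → ℤ) (d : ℝ) :
    shift (η + θ) d = shift η d + shift θ d := rfl

lemma dot_eind {n : ℕ} (i : Fin n) (c : ℝ) (v : Fin n × ℝ → ℤ) :
    dotP (eind i c) v = v (i, c) := by
  rw [dotP, finsum_eq_single _ (i, c)]
  · simp [eind]
  · intro p hp
    simp [eind, hp]

lemma dot_eind2 {n : ℕ} (i : Fin n) (c d : ℝ) (v : Fin n × ℝ → ℤ) :
    dotP (eind i c + eind i d) v = v (i, c) + v (i, d) := by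
  rw [← dot_eind i c v, ← dot_eind i d v, dotP, dotP, dotP, ← finsum_add_distrib]
  · simp [add_mul]
  · apply (Set.finite_singleton (i, c)).subset
    intro p hp
    by_contra h
    have h' : p ≠ (i, c) := h
    simp [eind, h'] at hp
  · apply (Set.finite_singleton (i, d)).subset
    intro p hp
    by_contra h
    have h' : p ≠ (i, d) := h
    simp [eind, h'] at hp

end GQV

/-- the matrix `L` defined by the values of `𝒩` on the level-1
degrees and the B-matrix `B̃` of the level-1 ice quiver with z-pattern satisfy
`L · (−B̃) = [2·Iₙ ; 0]`. Here `u i = C_q⁻¹ e_i(0)` and `u' i = C_q⁻¹(e_i(0)+e_i(−1))`. -/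
theorem L_Btilde_compatible (n : ℕ) (hn : 0 < n) (b : Matrix (Fin n) (Fin n) ℤ)
    (hskew : bᵀ = -b) (hsign : ∀ i j : Fin n, i < j → 0 ≤ b i j)
    (u u' : Fin n → (Fin n × ℝ → ℤ))
    (hu : ∀ i, GQV.memEhalf (u i) ∧ GQV.Cq b (u i) = GQV.eind i (0 : ℝ))
    (hu' : ∀ i, GQV.memEhalf (u' i) ∧
        GQV.Cq b (u' i) = GQV.eind i (0 : ℝ) + GQV.eind i (-1 : ℝ))
    (L : Matrix (Fin n ⊕ Fin n) (Fin n ⊕ Fin n) ℤ)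
    (hLll : ∀ i j, L (Sum.inl i) (Sum.inl j)
        = GQV.Ncal (GQV.eind i (0 : ℝ)) (GQV.eind j (0 : ℝ)) (u i) (u j))
    (hLlr : ∀ i j, L (Sum.inl i) (Sum.inr j)
        = GQV.Ncal (GQV.eind i (0 : ℝ)) (GQV.eind j (0 : ℝ) + GQV.eind j (-1 : ℝ)) (u i) (u' j))
    (hLrl : ∀ i j, L (Sum.inr i) (Sum.inl j)
        = GQV.Ncal (GQV.eind i (0 : ℝ) + GQV.eind i (-1 : ℝ)) (GQV.eind j (0 : ℝ)) (u' i) (u j))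
    (hLrr : ∀ i j, L (Sum.inr i) (Sum.inr j)
        = GQV.Ncal (GQV.eind i (0 : ℝ) + GQV.eind i (-1 : ℝ))
            (GQV.eind j (0 : ℝ) + GQV.eind j (-1 : ℝ)) (u' i) (u' j)) :
    L * (-GQV.Btilde b)
      = Matrix.of (Sum.elim (fun i k => if i = k then (2 : ℤ) else 0) (fun _ _ => 0)) := by
  set E := EQmat b with hE
  have hdet : IsUnit E.det := by rw [hE, EQ_det]; exact isUnit_one
  have hdetT : IsUnit Eᵀ.det := by rw [Matrix.det_transpose]; exact hdet
  set G := E⁻¹ with hG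
  set H := (Eᵀ)⁻¹ with hH
  have hGE : G * E = 1 := Matrix.nonsing_inv_mul _ hdet
  have hHE : H * Eᵀ = 1 := Matrix.nonsing_inv_mul _ hdetT
  have hGH : Gᵀ = H := Matrix.transpose_nonsing_inv E
  have hHG : Hᵀ = G := by rw [← hGH, Matrix.transpose_transpose]
  -- values
  have u0 : ∀ j a, a ≤ -(1 / 2) → (fun k => u j (k, a)) = 0 := by
    intro j a ha
    refine vanish b (u j) (hu j).1 0 ?_ a (by linarith)
    intro k a ha
    rw [(hu j).2]
    simp [eind, ha.ne]
  have u'0 : ∀ j a, a ≤ -(3 / 2) → (fun k => u' j (k, a)) = 0 := by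
    intro j a ha
    refine vanish b (u' j) (hu' j).1 (-1) ?_ a (by linarith)
    intro k a ha
    rw [(hu' j).2]
    have : a ≠ 0 := by linarith
    simp [eind, ha.ne, this]
  let U : ℝ → Matrix (Fin n) (Fin n) ℤ := fun a => Matrix.of fun i j => u j (i, a)
  let V : ℝ → Matrix (Fin n) (Fin n) ℤ := fun a => Matrix.of fun i j => u' j (i, a)
  have U0 : ∀ a, a ≤ -(1 / 2) → U a = 0 := by
    intro a ha
    ext i j
    exact congrFun (u0 j a ha) i
  have V0 : ∀ a, a ≤ -(3 / 2) → V a = 0 := by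
    intro a ha
    ext i j
    exact congrFun (u'0 j a ha) i
  have Urec : ∀ a, Eᵀ * U (a + 1 / 2) + E * U (a - 1 / 2)
      = Matrix.of fun i j => eind j (0 : ℝ) (i, a) := by
    intro a
    ext i j
    have h := Cq_eq b (u j) i a
    rw [(hu j).2] at h
    exact h.symm
  have Vrec : ∀ a, Eᵀ * V (a + 1 / 2) + E * V (a - 1 / 2)
      = Matrix.of fun i j => (eind j (0 : ℝ) + eind j (-1 : ℝ)) (i, a) := by
    intro a
    ext i j
    have h := Cq_eq b (u' j) i a
    rw [(hu' j).2] at h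
    exact h.symm
  have U1 : U (1 / 2) = H := by
    have h := Urec 0
    rw [U0 (0 - 1 / 2) (by norm_num)] at h
    have h1 : (Matrix.of fun i j : Fin n => eind j (0 : ℝ) (i, (0 : ℝ))) = 1 := by
      ext i j
      simp [eind, Matrix.one_apply]
    rw [h1, mul_zero, add_zero, zero_add] at h
    calc U (1 / 2) = (H * Eᵀ) * U (1 / 2) := by rw [hHE, one_mul]
      _ = H := by rw [mul_assoc, h, mul_one]
  have V1 : V (-(1 / 2)) = H := by
    have h := Vrec (-1)
    rw [V0 (-1 - 1 / 2) (by norm_num)] at h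
    have h1 : (Matrix.of fun i j : Fin n =>
        (eind j (0 : ℝ) + eind j (-1 : ℝ)) (i, (-1 : ℝ))) = 1 := by
      ext i j
      simp [eind, Matrix.one_apply]
    rw [h1, mul_zero, add_zero, show (-1 + 1 / 2 : ℝ) = -(1 / 2) by norm_num] at h
    calc V (-(1 / 2)) = (H * Eᵀ) * V (-(1 / 2)) := by rw [hHE, one_mul]
      _ = H := by rw [mul_assoc, h, mul_one]
  have V2 : V (1 / 2) = H - H * E * H := by
    have h := Vrec 0
    have h1 : (Matrix.of fun i j : Fin n =>
        (eind j (0 : ℝ) + eind j (-1 : ℝ)) (i, (0 : ℝ))) = 1 := by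
      ext i j
      simp [eind, Matrix.one_apply]
    rw [h1, zero_add, zero_sub, V1] at h
    calc V (1 / 2) = (H * Eᵀ) * V (1 / 2) := by rw [hHE, one_mul]
      _ = H * (Eᵀ * V (1 / 2) + E * H) - H * E * H := by noncomm_ring
      _ = _ := by rw [h, mul_one]
  have hu1 : ∀ j i, u j (i, 1 / 2) = H i j := fun j i => congrFun (congrFun U1 i) j
  have hu2 : ∀ j i, u j (i, -(1 / 2)) = 0 :=
    fun j i => congrFun (congrFun (U0 _ le_rfl) i) j
  have hu3 : ∀ j i, u j (i, -(3 / 2)) = 0 :=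
    fun j i => congrFun (congrFun (U0 (-(3 / 2)) (by norm_num)) i) j
  have hv1 : ∀ j i, u' j (i, -(1 / 2)) = H i j := fun j i => congrFun (congrFun V1 i) j
  have hv2 : ∀ j i, u' j (i, 1 / 2) = (H - H * E * H) i j :=
    fun j i => congrFun (congrFun V2 i) j
  have hv3 : ∀ j i, u' j (i, -(3 / 2)) = 0 :=
    fun j i => congrFun (congrFun (V0 _ le_rfl) i) j
  have c1 : (0 : ℝ) - 1 / 2 = -(1 / 2) := by norm_num
  have c2 : (0 : ℝ) - -(1 / 2) = 1 / 2 := by norm_num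
  have c3 : (-1 : ℝ) - 1 / 2 = -(3 / 2) := by norm_num
  have c4 : (-1 : ℝ) - -(1 / 2) = -(1 / 2) := by norm_num
  have hT : ∀ i j, H j i = G i j := fun i j => congrFun (congrFun hHG i) j
  have hT2 : ∀ i j, (H * E * H) j i = (G * Eᵀ * G) i j := by
    intro i j
    have : (H * E * H)ᵀ = G * Eᵀ * G := by
      rw [Matrix.transpose_mul, Matrix.transpose_mul, hHG, mul_assoc]
    rw [← this, Matrix.transpose_apply]
  have hL : L = Matrix.fromBlocks (G - H) (H * E * H + G) (-(G * Eᵀ * G + H))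
      (-(H - H * E * H) + (G - G * Eᵀ * G)) := by
    ext (i | i) (j | j)
    · rw [hLll]
      simp only [Ncal, shift_eind, dot_eind, c1, c2, hu1, hu2, Matrix.fromBlocks_apply₁₁,
        Matrix.sub_apply, ← hT i j]
      ring
    · rw [hLlr]
      simp only [Ncal, shift_add, shift_eind, dot_eind, dot_eind2, c1, c2, c3, c4, hu1, hu2, hu3,
        hv1, hv2, hv3, Matrix.fromBlocks_apply₁₂, Matrix.sub_apply, Matrix.add_apply, ← hT i j]
      ring
    · rw [hLrl]
      simp only [Ncal, shift_add, shift_eind, dot_eind, dot_eind2, c1, c2, c3, c4, hu1, hu2, hu3,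
        hv1, hv2, hv3, Matrix.fromBlocks_apply₂₁, Matrix.sub_apply, Matrix.add_apply,
        Matrix.neg_apply, ← hT2 i j]
      ring
    · rw [hLrr]
      simp only [Ncal, shift_add, shift_eind, dot_eind, dot_eind2, c1, c2, c3, c4, hu1, hu2, hu3,
        hv1, hv2, hv3, Matrix.fromBlocks_apply₂₂, Matrix.sub_apply, Matrix.add_apply,
        Matrix.neg_apply, ← hT2 i j, ← hT i j]
      ring
  have hB : -Btilde b = Matrix.fromRows (E - Eᵀ) Eᵀ := by
    ext (i | i) k
    · have hs : ∀ i j, b j i = - b i j := fun i j => congrFun (congrFun hskew i) j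
      simp only [Btilde, hE, EQmat, bUpper, Matrix.neg_apply, Matrix.of_apply, Sum.elim_inl,
        Matrix.fromRows_apply_inl, Matrix.sub_apply, Matrix.transpose_apply, Matrix.one_apply]
      rcases lt_trichotomy i k with h | h | h
      · simp [h, h.ne, h.ne', not_lt.mpr h.le]
      · subst h
        have := hs i i
        simp
        omega
      · simp [h, h.ne, h.ne', not_lt.mpr h.le, hs k i]
    · simp only [Btilde, hE, EQmat, bUpper, Matrix.neg_apply, Matrix.of_apply, Sum.elim_inr,
        Matrix.fromRows_apply_inr, Matrix.sub_apply, Matrix.transpose_apply, Matrix.one_apply,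
        eq_comm (a := i)]
      ring
  have e1 : (G - H) * (E - Eᵀ) + (H * E * H + G) * Eᵀ = 2 := by
    calc _ = G * E + H * Eᵀ - H * E + H * E * (H * Eᵀ) := by noncomm_ring
      _ = 2 := by rw [hGE, hHE, mul_one, sub_add_cancel]; norm_num
  have e2 : -(G * Eᵀ * G + H) * (E - Eᵀ) + (-(H - H * E * H) + (G - G * Eᵀ * G)) * Eᵀ = 0 := by
    calc _ = - (G * Eᵀ * (G * E)) - H * E + H * E * (H * Eᵀ) + G * Eᵀ := by noncomm_ring
      _ = 0 := by rw [hGE, hHE, mul_one, mul_one]; noncomm_ring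
  rw [hL, hB, Matrix.fromBlocks_mul_fromRows, e1, e2]
  ext (i | i) k
  · simp [Matrix.ofNat_apply]
  · simp
end

section
/- For every 1 ≤ k ≤ n: (ϖ_k, β_{ξ(k)+n}) = 1 + (β_{ξ(k)}, β_{ξ(k)+n}). -/
namespace RootDatum

variable {V : Type*} [AddCommGroup V] [Module ℝ V]

/-- The reflection `s_i(x) = x − (x, α_i) α_i` associated with the simple root `α_i`. -/
def refl (B : V →ₗ[ℝ] V →ₗ[ℝ] ℝ) (α : ℕ → V) (i : ℕ) (x : V) : V :=
  x - B x (α i) • α i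

/-- Apply the word of reflections `s_{l_m} ⋯ s_{l_2} s_{l_1}` (leftmost entry of the
list acting first) to `x`. -/
def applyWord (B : V →ₗ[ℝ] V →ₗ[ℝ] ℝ) (α : ℕ → V) (l : List ℕ) (x : V) : V :=
  l.foldl (fun y i => refl B α i y) x

/-- The positive root `β_{ξ(k)} = s_n s_{n−1} ⋯ s_{k+1}(α_k)`, attached to position
`ξ(k) = n+1−k` of the reduced word `(n, …, 1, n, …, 1)` of `c²`,
where `c = s_n s_{n−1} ⋯ s_1`. -/
def betaXi (B : V →ₗ[ℝ] V →ₗ[ℝ] ℝ) (α : ℕ → V) (n k : ℕ) : V :=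
  applyWord B α (List.range' (k + 1) (n - k)) (α k)

/-- The positive root `β_{ξ(k)+n} = s_n ⋯ s_1 s_n ⋯ s_{k+1}(α_k)`, attached to position
`ξ(k)+n` of the reduced word `(n, …, 1, n, …, 1)` of `c²`. -/
def betaXiN (B : V →ₗ[ℝ] V →ₗ[ℝ] ℝ) (α : ℕ → V) (n k : ℕ) : V :=
  applyWord B α (List.range' (k + 1) (n - k) ++ List.range' 1 n) (α k)

end RootDatum


namespace RootDatum

theorem aux_isom {V : Type*} [AddCommGroup V] [Module ℝ V]
    (B : V →ₗ[ℝ] V →ₗ[ℝ] ℝ) (hsymm : ∀ x y : V, B x y = B y x) (α : ℕ → V) (l : List ℕ)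
    (hl : ∀ i ∈ l, B (α i) (α i) = 2) (x y : V) :
    B (applyWord B α l x) (applyWord B α l y) = B x y := by
  induction l generalizing x y with
  | nil => rfl
  | cons i l ih =>
    have h := ih (fun j hj => hl j (List.mem_cons_of_mem _ hj)) (refl B α i x) (refl B α i y)
    have h2 := hl i List.mem_cons_self
    refine h.trans ?_
    simp only [refl, map_sub, map_smul, LinearMap.sub_apply, LinearMap.smul_apply, smul_eq_mul, h2,
      hsymm (α i) y]
    ring

theorem aux_fix {V : Type*} [AddCommGroup V] [Module ℝ V]
    (B : V →ₗ[ℝ] V →ₗ[ℝ] ℝ) (α : ℕ → V) (l : List ℕ) (w : V)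
    (hl : ∀ i ∈ l, B w (α i) = 0) : applyWord B α l w = w := by
  induction l with
  | nil => rfl
  | cons i l ih =>
    have h := ih (fun j hj => hl j (List.mem_cons_of_mem _ hj))
    have h2 := hl i List.mem_cons_self
    have h3 : refl B α i w = w := by simp [refl, h2]
    change applyWord B α l (refl B α i w) = w
    rw [h3, h]

theorem aux_sub {V : Type*} [AddCommGroup V] [Module ℝ V]
    (B : V →ₗ[ℝ] V →ₗ[ℝ] ℝ) (α : ℕ → V) (l : List ℕ) (x y : V) :
    applyWord B α l (x - y) = applyWord B α l x - applyWord B α l y := by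
  induction l generalizing x y with
  | nil => rfl
  | cons i l ih =>
    change applyWord B α l (refl B α i (x - y)) =
      applyWord B α l (refl B α i x) - applyWord B α l (refl B α i y)
    rw [← ih]
    congr 1
    simp only [refl, map_sub, LinearMap.sub_apply, sub_smul]
    abel

theorem aux_append {V : Type*} [AddCommGroup V] [Module ℝ V]
    (B : V →ₗ[ℝ] V →ₗ[ℝ] ℝ) (α : ℕ → V) (l m : List ℕ) (x : V) :
    applyWord B α (l ++ m) x = applyWord B α m (applyWord B α l x) :=
  List.foldl_append

end RootDatum

/-- `(ϖ_k, β_{ξ(k)+n}) = 1 + (β_{ξ(k)}, β_{ξ(k)+n})`. -/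
theorem weight_pairing_with_betaXiN (n : ℕ) (hn : 0 < n) {V : Type*} [AddCommGroup V] [Module ℝ V]
    (B : V →ₗ[ℝ] V →ₗ[ℝ] ℝ) (hsymm : ∀ x y : V, B x y = B y x)
    (α ϖ : ℕ → V)
    (hα : ∀ i, 1 ≤ i → i ≤ n → B (α i) (α i) = 2)
    (hϖ : ∀ i j, 1 ≤ i → i ≤ n → 1 ≤ j → j ≤ n →
        B (ϖ i) (α j) = if i = j then 1 else 0)
    (k : ℕ) (hk1 : 1 ≤ k) (hkn : k ≤ n) :
    B (ϖ k) (RootDatum.betaXiN B α n k)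
      = 1 + B (RootDatum.betaXi B α n k) (RootDatum.betaXiN B α n k) := by
  have hN : RootDatum.betaXiN B α n k =
      RootDatum.applyWord B α (List.range' 1 n) (RootDatum.betaXi B α n k) :=
    RootDatum.aux_append B α _ _ _
  have hsplit : List.range' 1 n =
      List.range' 1 (k - 1) ++ ([k] ++ List.range' (k + 1) (n - k)) := by
    have h1 : [k] ++ List.range' (k + 1) (n - k) = List.range' k (n - k + 1) := by
      simp [List.range'_succ]
    rw [h1]
    have h2 := List.range'_append_1 (s := 1) (m := k - 1) (n := n - k + 1)
    rw [show 1 + (k - 1) = k by omega, show k - 1 + (n - k + 1) = n by omega] at h2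
    exact h2.symm
  have hc : RootDatum.applyWord B α (List.range' 1 n) (ϖ k) =
      ϖ k - RootDatum.betaXi B α n k := by
    rw [hsplit, RootDatum.aux_append, RootDatum.aux_append, RootDatum.aux_fix B α _ (ϖ k)]
    · have h3 : RootDatum.applyWord B α [k] (ϖ k) = ϖ k - α k := by
        simp [RootDatum.applyWord, RootDatum.refl, hϖ k k hk1 hkn hk1 hkn]
      rw [h3, RootDatum.aux_sub, RootDatum.aux_fix B α _ (ϖ k)]
      · rfl
      · intro i hi
        rw [List.mem_range'_1] at hi
        rw [hϖ k i hk1 hkn (by omega) (by omega), if_neg (by omega)]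
    · intro i hi
      rw [List.mem_range'_1] at hi
      rw [hϖ k i hk1 hkn (by omega) (by omega), if_neg (by omega)]
  have hb : B (ϖ k) (RootDatum.betaXi B α n k) = 1 := by
    have h4 := RootDatum.aux_isom B hsymm α (List.range' (k + 1) (n - k)) (by
      intro i hi
      rw [List.mem_range'_1] at hi
      exact hα i (by omega) (by omega)) (ϖ k) (α k)
    rw [RootDatum.aux_fix B α _ (ϖ k)] at h4
    · rw [hϖ k k hk1 hkn hk1 hkn, if_pos rfl] at h4
      exact h4
    · intro i hi
      rw [List.mem_range'_1] at hi
      rw [hϖ k i hk1 hkn (by omega) (by omega), if_neg (by omega)]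
  have h5 := RootDatum.aux_isom B hsymm α (List.range' 1 n) (by
      intro i hi
      rw [List.mem_range'_1] at hi
      exact hα i (by omega) (by omega)) (ϖ k) (RootDatum.betaXi B α n k)
  rw [hc, ← hN, hb, map_sub, LinearMap.sub_apply] at h5
  linarith
end

section
/- For every 1 ≤ k ≤ n: (ϖ_k − β_{ξ(k)}, β_{ξ(k)} + β_{ξ(k)+n}) = 0. (This is the vanishing of the exponent B in the quantum T-system identity of the quantum cluster algebra.) -/
namespace RootDatum

variable {V : Type*} [AddCommGroup V] [Module ℝ V]

theorem applyWord_sub (B : V →ₗ[ℝ] V →ₗ[ℝ] ℝ) (α : ℕ → V) (l : List ℕ) (x y : V) :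
    applyWord B α l (x - y) = applyWord B α l x - applyWord B α l y := by
  induction l generalizing x y with
  | nil => rfl
  | cons i l ih =>
    have h : refl B α i (x - y) = refl B α i x - refl B α i y := by
      simp only [refl, map_sub, LinearMap.sub_apply, sub_smul]; abel
    show applyWord B α l (refl B α i (x - y)) = _
    rw [h, ih]; rfl

theorem applyWord_isom (B : V →ₗ[ℝ] V →ₗ[ℝ] ℝ) (hsymm : ∀ x y : V, B x y = B y x)
    (α : ℕ → V) (l : List ℕ) (hl : ∀ i ∈ l, B (α i) (α i) = 2) (x y : V) :
    B (applyWord B α l x) (applyWord B α l y) = B x y := by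
  induction l generalizing x y with
  | nil => rfl
  | cons i l ih =>
    show B (applyWord B α l (refl B α i x)) (applyWord B α l (refl B α i y)) = _
    rw [ih (fun j hj => hl j (List.mem_cons_of_mem _ hj))]
    simp only [refl, map_sub, LinearMap.sub_apply, map_smul, LinearMap.smul_apply, smul_eq_mul,
      hl i List.mem_cons_self, hsymm (α i) y]
    ring

theorem applyWord_pair (B : V →ₗ[ℝ] V →ₗ[ℝ] ℝ)
    (α : ℕ → V) (l : List ℕ) (w : V) (hl : ∀ i ∈ l, B w (α i) = 0) (x : V) :
    B w (applyWord B α l x) = B w x := by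
  induction l generalizing x with
  | nil => rfl
  | cons i l ih =>
    show B w (applyWord B α l (refl B α i x)) = _
    rw [ih (fun j hj => hl j (List.mem_cons_of_mem _ hj))]
    simp [refl, hl i List.mem_cons_self]

theorem applyWord_fix (B : V →ₗ[ℝ] V →ₗ[ℝ] ℝ)
    (α : ℕ → V) (l : List ℕ) (w : V) (hl : ∀ i ∈ l, B w (α i) = 0) :
    applyWord B α l w = w := by
  induction l with
  | nil => rfl
  | cons i l ih =>
    show applyWord B α l (refl B α i w) = _
    have : refl B α i w = w := by simp [refl, hl i List.mem_cons_self]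
    rw [this, ih (fun j hj => hl j (List.mem_cons_of_mem _ hj))]

end RootDatum


/-- `(ϖ_k − β_{ξ(k)}, β_{ξ(k)} + β_{ξ(k)+n}) = 0`; the exponent `B`
in the quantum T-system vanishes. -/
theorem Tsystem_exponent_B_vanishes (n : ℕ) (hn : 0 < n) {V : Type*} [AddCommGroup V] [Module ℝ V]
    (B : V →ₗ[ℝ] V →ₗ[ℝ] ℝ) (hsymm : ∀ x y : V, B x y = B y x)
    (α ϖ : ℕ → V)
    (hα : ∀ i, 1 ≤ i → i ≤ n → B (α i) (α i) = 2)
    (hϖ : ∀ i j, 1 ≤ i → i ≤ n → 1 ≤ j → j ≤ n →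
        B (ϖ i) (α j) = if i = j then 1 else 0)
    (k : ℕ) (hk1 : 1 ≤ k) (hkn : k ≤ n) :
    B (ϖ k - RootDatum.betaXi B α n k)
      (RootDatum.betaXi B α n k + RootDatum.betaXiN B α n k) = 0 := by
  have hlo : ∀ i ∈ List.range' 1 (k - 1), B (ϖ k) (α i) = 0 := by
    intro i hi
    rw [List.mem_range'_1] at hi
    rw [hϖ k i hk1 hkn (by omega) (by omega), if_neg (by omega)]
  have hhi : ∀ i ∈ List.range' (k + 1) (n - k), B (ϖ k) (α i) = 0 := by
    intro i hi
    rw [List.mem_range'_1] at hi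
    rw [hϖ k i hk1 hkn (by omega) (by omega), if_neg (by omega)]
  have hkk : B (ϖ k) (α k) = 1 := by rw [hϖ k k hk1 hkn hk1 hkn, if_pos rfl]
  have hN : RootDatum.betaXiN B α n k =
      RootDatum.applyWord B α (List.range' 1 n) (RootDatum.betaXi B α n k) := by
    simp only [RootDatum.betaXiN, RootDatum.betaXi, RootDatum.applyWord, List.foldl_append]
  have hsplit : List.range' 1 n =
      List.range' 1 (k - 1) ++ (k :: List.range' (k + 1) (n - k)) := by
    rw [← List.range'_succ]
    have h := @List.range'_append_1 1 (k - 1) (n - k + 1)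
    rw [show 1 + (k - 1) = k by omega, show k - 1 + (n - k + 1) = n by omega] at h
    exact h.symm
  have hc : RootDatum.applyWord B α (List.range' 1 n) (ϖ k) =
      ϖ k - RootDatum.betaXi B α n k := by
    have h1 : RootDatum.applyWord B α (List.range' 1 n) (ϖ k) =
        RootDatum.applyWord B α (List.range' (k + 1) (n - k))
          (RootDatum.refl B α k (RootDatum.applyWord B α (List.range' 1 (k - 1)) (ϖ k))) := by
      rw [hsplit]
      simp only [RootDatum.applyWord, List.foldl_append, List.foldl_cons]
    rw [h1, RootDatum.applyWord_fix B α _ _ hlo, RootDatum.refl, hkk, one_smul,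
      RootDatum.applyWord_sub, RootDatum.applyWord_fix B α _ _ hhi]
    rfl
  have hb : B (ϖ k) (RootDatum.betaXi B α n k) = 1 := by
    rw [RootDatum.betaXi, RootDatum.applyWord_pair B α _ _ hhi, hkk]
  have hbb : B (RootDatum.betaXi B α n k) (RootDatum.betaXi B α n k) = 2 := by
    rw [RootDatum.betaXi, RootDatum.applyWord_isom B hsymm, hα k hk1 hkn]
    intro i hi
    rw [List.mem_range'_1] at hi
    exact hα i (by omega) (by omega)
  have h2 : B (ϖ k - RootDatum.betaXi B α n k) (RootDatum.betaXiN B α n k) = 1 := by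
    rw [← hc, hN, RootDatum.applyWord_isom B hsymm, hb]
    intro i hi
    rw [List.mem_range'_1] at hi
    exact hα i (by omega) (by omega)
  rw [map_add, h2, map_sub, LinearMap.sub_apply, hb, hbb]
  norm_num
end

section
/- For every 1 ≤ k ≤ n: (ϖ_k − β_{ξ(k)} − β_{ξ(k)+n}, β_{ξ(k)}) = −1 − (β_{ξ(k)}, β_{ξ(k)+n}). (This computes the exponent A in the quantum T-system identity of the quantum cluster algebra.) -/
theorem applyWord_norm {V : Type*} [AddCommGroup V] [Module ℝ V]
    (B : V →ₗ[ℝ] V →ₗ[ℝ] ℝ) (hsymm : ∀ x y : V, B x y = B y x) (α : ℕ → V) (l : List ℕ)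
    (hl : ∀ i ∈ l, B (α i) (α i) = 2) (x : V) :
    B (RootDatum.applyWord B α l x) (RootDatum.applyWord B α l x) = B x x := by
  induction l generalizing x with
  | nil => rfl
  | cons i l ih =>
    have h1 : RootDatum.applyWord B α (i :: l) x
        = RootDatum.applyWord B α l (RootDatum.refl B α i x) := rfl
    rw [h1, ih (fun j hj => hl j (List.mem_cons_of_mem _ hj))]
    have h2 := hl i List.mem_cons_self
    simp only [RootDatum.refl, map_sub, map_smul, LinearMap.sub_apply, LinearMap.smul_apply,
      smul_eq_mul, h2, hsymm (α i) x]
    ring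

theorem applyWord_pair {V : Type*} [AddCommGroup V] [Module ℝ V]
    (B : V →ₗ[ℝ] V →ₗ[ℝ] ℝ) (α : ℕ → V) (w : V) (l : List ℕ)
    (hl : ∀ i ∈ l, B w (α i) = 0) (x : V) :
    B w (RootDatum.applyWord B α l x) = B w x := by
  induction l generalizing x with
  | nil => rfl
  | cons i l ih =>
    have h1 : RootDatum.applyWord B α (i :: l) x
        = RootDatum.applyWord B α l (RootDatum.refl B α i x) := rfl
    rw [h1, ih (fun j hj => hl j (List.mem_cons_of_mem _ hj))]
    simp [RootDatum.refl, hl i List.mem_cons_self]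

/-- `(ϖ_k − β_{ξ(k)} − β_{ξ(k)+n}, β_{ξ(k)}) = −1 − (β_{ξ(k)}, β_{ξ(k)+n})`;
this computes the exponent `A` in the quantum T-system. -/
theorem Tsystem_exponent_A (n : ℕ) (hn : 0 < n) {V : Type*} [AddCommGroup V] [Module ℝ V]
    (B : V →ₗ[ℝ] V →ₗ[ℝ] ℝ) (hsymm : ∀ x y : V, B x y = B y x)
    (α ϖ : ℕ → V)
    (hα : ∀ i, 1 ≤ i → i ≤ n → B (α i) (α i) = 2)
    (hϖ : ∀ i j, 1 ≤ i → i ≤ n → 1 ≤ j → j ≤ n →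
        B (ϖ i) (α j) = if i = j then 1 else 0)
    (k : ℕ) (hk1 : 1 ≤ k) (hkn : k ≤ n) :
    B (ϖ k - RootDatum.betaXi B α n k - RootDatum.betaXiN B α n k)
      (RootDatum.betaXi B α n k)
      = -1 - B (RootDatum.betaXi B α n k) (RootDatum.betaXiN B α n k) := by
  have h1 : B (RootDatum.betaXi B α n k) (RootDatum.betaXi B α n k) = 2 := by
    unfold RootDatum.betaXi
    rw [applyWord_norm B hsymm α _ _ _, hα k hk1 hkn]
    intro i hi
    rw [List.mem_range'_1] at hi
    exact hα i (by omega) (by omega)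
  have h2 : B (ϖ k) (RootDatum.betaXi B α n k) = 1 := by
    unfold RootDatum.betaXi
    rw [applyWord_pair B α (ϖ k) _ _ _, hϖ k k hk1 hkn hk1 hkn, if_pos rfl]
    intro i hi
    rw [List.mem_range'_1] at hi
    rw [hϖ k i hk1 hkn (by omega) (by omega), if_neg (by omega)]
  rw [map_sub, map_sub, LinearMap.sub_apply, LinearMap.sub_apply, h1, h2,
    hsymm (RootDatum.betaXiN B α n k)]
  ring
end

section
/- For every w : I × {−1, 0} → ℤ and every v : I × {−1/2} → ℤ (equivalently v ∈ ℤ^n, placed in half-degree −1/2), the function w − C_q v is again supported on I × {−1, 0}, and ind(w − C_q v) = ind(w) + B̃ v in ℤ^{2n}. -/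
open Matrix GQV

/-- for `w` supported on `I × {−1, 0}` and `v` supported on
`I × {−1/2}`, the function `w − C_q v` is again supported on `I × {−1, 0}`, and
`ind(w − C_q v) = ind(w) + B̃ v` in `ℤ^(2n)`. -/
theorem ind_of_reduction (n : ℕ) (hn : 0 < n) (b : Matrix (Fin n) (Fin n) ℤ)
    (hskew : bᵀ = -b) (hsign : ∀ i j : Fin n, i < j → 0 ≤ b i j)
    (w v : Fin n × ℝ → ℤ)
    (hw : ∀ p, w p ≠ 0 → p.2 = -1 ∨ p.2 = 0)
    (hv : ∀ p, v p ≠ 0 → p.2 = -(1 / 2)) :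
    (∀ p, (w - GQV.Cq b v) p ≠ 0 → p.2 = -1 ∨ p.2 = 0) ∧
    GQV.indMap (w - GQV.Cq b v)
      = GQV.indMap w + GQV.Btilde b *ᵥ (fun k => v (k, -(1 / 2))) := by
  have hz : ∀ (k : Fin n) (a : ℝ), a ≠ -(1 / 2) → v (k, a) = 0 := by
    intro k a ha
    by_contra h
    exact ha (hv (k, a) h)
  have h0 : ∀ k, GQV.Cq b v (k, 0) = v (k, -(1 / 2))
      - ∑ j : Fin n, (if k < j then b k j * v (j, -(1 / 2)) else 0) := by
    intro k
    have e1 : (0 : ℝ) - 1 / 2 = -(1 / 2) := by norm_num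
    have e2 : ∀ i, v (i, (0 : ℝ) + 1 / 2) = 0 := fun i => hz i _ (by norm_num)
    simp only [GQV.Cq, e1, e2]
    simp
  have h1 : ∀ k, GQV.Cq b v (k, -1) = v (k, -(1 / 2))
      - ∑ i : Fin n, (if i < k then b i k * v (i, -(1 / 2)) else 0) := by
    intro k
    have e1 : (-1 : ℝ) + 1 / 2 = -(1 / 2) := by norm_num
    have e2 : ∀ i, v (i, (-1 : ℝ) - 1 / 2) = 0 := fun i => hz i _ (by norm_num)
    simp only [GQV.Cq, e1, e2]
    simp
  have hs : ∀ i j, b j i = - b i j := fun i j => congrFun (congrFun hskew i) j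
  refine ⟨?_, ?_⟩
  · rintro ⟨k, a⟩ hp
    by_contra hcon
    simp only [not_or] at hcon
    obtain ⟨ha, hb⟩ := hcon
    apply hp
    have hw0 : w (k, a) = 0 := by
      by_contra h
      rcases hw (k, a) h with h | h
      · exact ha h
      · exact hb h
    have e1 : ∀ i, v (i, a + 1 / 2) = 0 :=
      fun i => hz i _ (fun h => ha (by linarith))
    have e2 : ∀ i, v (i, a - 1 / 2) = 0 :=
      fun i => hz i _ (fun h => hb (by linarith))
    simp only [Pi.sub_apply, GQV.Cq, hw0, e1, e2]
    simp
  · funext x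
    rcases x with k | k
    · have key : ∑ j : Fin n, b k j * v (j, -(1 / 2))
          = ∑ j : Fin n, (if k < j then b k j * v (j, -(1 / 2)) else 0)
            - ∑ i : Fin n, (if i < k then b i k * v (i, -(1 / 2)) else 0) := by
        rw [← Finset.sum_sub_distrib]
        refine Finset.sum_congr rfl fun j _ => ?_
        rcases lt_trichotomy k j with h | h | h
        · simp [h, h.not_gt]
        · subst h
          have : b k k = 0 := by have := hs k k; omega
          simp [this]
        · simp [h, h.not_gt, hs k j]
      simp only [GQV.indMap, Sum.elim_inl, Pi.add_apply, Pi.sub_apply, h0, h1, Matrix.mulVec,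
        dotProduct, GQV.Btilde, Matrix.of_apply]
      rw [key]
      ring
    · simp only [GQV.indMap, Sum.elim_inr, Pi.add_apply, Pi.sub_apply, h1, Matrix.mulVec,
        dotProduct, GQV.Btilde, Matrix.of_apply, add_mul, Finset.sum_add_distrib, ite_mul,
        neg_mul, one_mul, zero_mul, Finset.sum_neg_distrib, Finset.sum_ite_eq,
        Finset.mem_univ, if_true]
      ring
end
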